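/- Let d be a positive integer and f : {0,…,d+1} → {0,…,d+1} a non-decreasing function with f(0) = 0 and f(d+1) = d+1. Then there exist ℓ ≤ d³ basic functions g_1,…,g_ℓ relative to d such that f = g_ℓ ∘ g_{ℓ−1} ∘ ⋯ ∘ g_1. -/

import Mathlib

namespace CocPaper

open SimpleGraph

variable {V : Type} {W : Type}

/-- `S` is a `d`-coc set of the subgraph of `G` induced on the vertex set `A`:
after deleting `S`, every connected component has at most `d` vertices. -/
def IsCocSetOn (G : SimpleGraph V) (A : Set V) (d : ℕ) (S : Set V) : Prop :=
  ∀ c : (G.induce (A \ S)).ConnectedComponent, c.supp.ncard ≤ d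

/-- The minimum size of a `d`-coc set of the subgraph of `G` induced on `A`. -/
noncomputable def cocOptOn (G : SimpleGraph V) (A : Set V) (d : ℕ) : ℕ :=
  sInf {m : ℕ | ∃ S : Set V, S ⊆ A ∧ IsCocSetOn G A d S ∧ S.ncard = m}

/-- `S` is a minimum `d`-coc set of the subgraph of `G` induced on `A`. -/
def IsMinCocSetOn (G : SimpleGraph V) (A : Set V) (d : ℕ) (S : Set V) : Prop :=
  S ⊆ A ∧ IsCocSetOn G A d S ∧ S.ncard = cocOptOn G A d

/-- `X` is a `d`-blocking set of `G[A]`: no minimum `d`-coc set contains `X`. -/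
def IsBlockingSetOn (G : SimpleGraph V) (A : Set V) (d : ℕ) (X : Set V) : Prop :=
  ∀ S : Set V, IsMinCocSetOn G A d S → ¬ X ⊆ S

/-- A minimal `d`-blocking set: a `d`-blocking set no proper subset of which is one. -/
def IsMinimalBlockingSetOn (G : SimpleGraph V) (A : Set V) (d : ℕ) (X : Set V) : Prop :=
  IsBlockingSetOn G A d X ∧ ∀ Y : Set V, Y ⊂ X → ¬ IsBlockingSetOn G A d Y

/-- `G` is (isomorphic to) a path graph, possibly empty. -/
def IsPathGraph (G : SimpleGraph V) : Prop :=
  ∃ n : ℕ, Nonempty (G ≃g SimpleGraph.pathGraph n)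

/-- A caterpillar: a tree such that deleting all vertices of degree one yields a
(possibly empty) path. -/
def IsCaterpillar (G : SimpleGraph V) : Prop :=
  G.IsTree ∧ IsPathGraph (G.induce {v : V | (G.neighborSet v).ncard ≠ 1})

/-- A caterpillar forest: every connected component is a caterpillar. -/
def IsCaterpillarForest (G : SimpleGraph V) : Prop :=
  ∀ c : G.ConnectedComponent, IsCaterpillar (G.induce c.supp)

/-- `G` is (isomorphic to) a cycle graph. -/
def IsCycleGraph (G : SimpleGraph V) : Prop :=
  ∃ n : ℕ, 3 ≤ n ∧ Nonempty (G ≃g SimpleGraph.cycleGraph n)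

/-- A connected subgraph of `G` which is a caterpillar, equipped with a fixed
nonempty spine listed in left-to-right order: the spine is a path in `G` inside
`verts`, and every vertex of `verts` off the spine has degree one in the subgraph. -/
structure SubCaterpillar (G : SimpleGraph V) where
  verts : Set V
  n : ℕ
  npos : 0 < n
  spine : Fin n → V
  spineMem : ∀ i, spine i ∈ verts
  spineInj : Function.Injective spine
  spineAdj : ∀ (i : ℕ) (h : i + 1 < n),
    G.Adj (spine ⟨i, Nat.lt_of_succ_lt h⟩) (spine ⟨i + 1, h⟩)
  isTree : (G.induce verts).IsTree
  pendant : ∀ v ∈ verts, v ∉ Set.range spine → {w : V | w ∈ verts ∧ G.Adj v w}.ncard = 1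

/-- The spine position of a vertex of the caterpillar: its spine index if it is a
spine vertex, and the spine index of its parent if it is a pendant. -/
noncomputable def SubCaterpillar.pos {G : SimpleGraph V} (C : SubCaterpillar G) (v : V) : ℕ :=
  sInf {i : ℕ | ∃ h : i < C.n,
    C.spine ⟨i, h⟩ = v ∨ (v ∉ Set.range C.spine ∧ G.Adj v (C.spine ⟨i, h⟩))}

/-- `P` is a solution-tight packing of the spined caterpillar `C` with respect to `d`.
Packed (induced, connected) subgraphs are represented by their vertex sets. -/
def IsSTP (G : SimpleGraph V) (d : ℕ) (C : SubCaterpillar G) (P : Finset (Set V)) : Prop :=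
  (∀ A ∈ P, A ⊆ C.verts ∧ d + 1 ≤ A.ncard ∧ (G.induce A).Connected) ∧
  ((↑P : Set (Set V)).Pairwise fun A B => Disjoint A B) ∧
  P.card = cocOptOn G C.verts d ∧
  (∀ A ∈ P, ∀ v ∈ C.verts, v ∉ Set.range C.spine → ∀ w ∈ A, G.Adj v w → v ∈ A) ∧
  (∃ i : ℕ, i ≤ C.n ∧ ∀ j : Fin C.n, ((j : ℕ) < i ↔ ∃ A ∈ P, C.spine j ∈ A)) ∧
  (∀ A ∈ P, ∀ j : Fin C.n, C.spine j ∈ A →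
    (∀ j' : Fin C.n, C.spine j' ∈ A → (j' : ℕ) ≤ (j : ℕ)) →
    IsCocSetOn G A d {C.spine j})

/-- A caterpillar forest on the vertex set `F` inside the ambient graph `G`,
with a fixed spine and spine order for each connected component. -/
structure SpinedCatForest (G : SimpleGraph V) (F : Set V) where
  numComps : ℕ
  comp : Fin numComps → SubCaterpillar G
  sub : ∀ c, (comp c).verts ⊆ F
  cover : ∀ v ∈ F, ∃ c, v ∈ (comp c).verts
  disj : ∀ c c', c ≠ c' → Disjoint (comp c).verts (comp c').verts
  noCross : ∀ c c', c ≠ c' → ∀ v ∈ (comp c).verts, ∀ w ∈ (comp c').verts, ¬ G.Adj v w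

/-- `P` is a solution-tight packing of the caterpillar forest `𝔉`: the union over the
connected components of solution-tight packings of the components. -/
def IsForestSTP (G : SimpleGraph V) (d : ℕ) {F : Set V} (𝔉 : SpinedCatForest G F)
    (P : Finset (Set V)) : Prop :=
  ∃ Q : Fin 𝔉.numComps → Finset (Set V),
    (∀ c, IsSTP G d (𝔉.comp c) (Q c)) ∧
    (↑P : Set (Set V)) = ⋃ c, (↑(Q c) : Set (Set V))

/-- Attach `x` new pendant vertices to the vertex `v` of `H`. -/
def attachPendants (H : SimpleGraph W) (v : W) (x : ℕ) : SimpleGraph (W ⊕ Fin x) :=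
  SimpleGraph.fromRel fun a b =>
    (∃ u u', a = Sum.inl u ∧ b = Sum.inl u' ∧ H.Adj u u') ∨
    (∃ i : Fin x, a = Sum.inl v ∧ b = Sum.inr i)

/-- The number of vertices of the connected component of `v` in the graph obtained
from `G[A]` by deleting `S` (this is `0` when `v ∈ S` or `v ∉ A`). -/
noncomputable def compSizeOn (G : SimpleGraph V) (A S : Set V) (v : V) : ℕ :=
  {w : V | ∃ (hv : v ∈ A \ S) (hw : w ∈ A \ S),
    (G.induce (A \ S)).Reachable ⟨v, hv⟩ ⟨w, hw⟩}.ncard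

/-- The essence of a spined caterpillar `C` relative to `d`. -/
noncomputable def SubCaterpillar.essence {G : SimpleGraph V} (C : SubCaterpillar G)
    (d : ℕ) : ℕ → ℕ := fun x =>
  let Cx : SimpleGraph (↥C.verts ⊕ Fin x) :=
    attachPendants (G.induce C.verts) ⟨C.spine ⟨0, C.npos⟩, C.spineMem ⟨0, C.npos⟩⟩ x
  let vlast : ↥C.verts ⊕ Fin x :=
    Sum.inl ⟨C.spine ⟨C.n - 1, Nat.sub_lt C.npos Nat.one_pos⟩,
      C.spineMem ⟨C.n - 1, Nat.sub_lt C.npos Nat.one_pos⟩⟩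
  if x ≤ d ∧ cocOptOn Cx Set.univ d = cocOptOn G C.verts d then
    sInf {b : ℕ | ∃ Y : Set (↥C.verts ⊕ Fin x),
      IsMinCocSetOn Cx Set.univ d Y ∧ b = compSizeOn Cx Set.univ Y vlast}
  else d + 1

/-- The set of vertices of `A` adjacent (in `G`) to some vertex of `X`. -/
def nbrIn (G : SimpleGraph V) (A X : Set V) : Set V :=
  {v : V | v ∈ A ∧ ∃ m ∈ X, G.Adj v m}

/-- The chunk `X` imposes a (strictly positive) conflict on the subgraph of `G`
induced on the vertex set `A`. -/
def HasConflict (G : SimpleGraph V) (d : ℕ) (A X : Set V) : Prop :=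
  cocOptOn G A d < (nbrIn G A X).ncard + cocOptOn G (A \ nbrIn G A X) d

/-- A chunk: a subset of the modulator `M` of size one or two. -/
def IsChunk (M X : Set V) : Prop := X ⊆ M ∧ 1 ≤ X.ncard ∧ X.ncard ≤ 2

/-- The `i`-th graph (0-based) of the `α`-merged packing of the ordered packing `H`. -/
def mergedPiece {t : ℕ} (H : Fin t → Set V) (α i : ℕ) : Set V :=
  ⋃ (j : Fin t) (_ : i * α ≤ (j : ℕ) ∧ (j : ℕ) < i * α + α), H j

/-- `H` enumerates a solution-tight packing of `C` in left-to-right spine order. -/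
def IsOrderedSTP (G : SimpleGraph V) (d : ℕ) (C : SubCaterpillar G) {t : ℕ}
    (H : Fin t → Set V) : Prop :=
  Function.Injective H ∧
  (∃ P : Finset (Set V), IsSTP G d C P ∧ (↑P : Set (Set V)) = Set.range H) ∧
  ∀ k k' : Fin t, k < k' → ∀ v ∈ H k, ∀ w ∈ H k', C.pos v < C.pos w

/-- Composition of a list of functions: `compList [g₁, …, gₗ] = g₁ ∘ g₂ ∘ ⋯ ∘ gₗ`. -/
def compList (L : List (ℕ → ℕ)) : ℕ → ℕ := L.foldr (· ∘ ·) id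

/-- `inc^d_i`: maps `i` to `i+1` and fixes all other inputs. -/
def incAt (i : ℕ) : ℕ → ℕ := fun x => if x = i then i + 1 else x

/-- `dec^d_i`: maps `i` to `i-1` and fixes all other inputs. -/
def decAt (i : ℕ) : ℕ → ℕ := fun x => if x = i then i - 1 else x

/-- `inc^d`: maps every `x` with `1 ≤ x ≤ d` to `x+1` and fixes all other inputs. -/
def incUpTo (d : ℕ) : ℕ → ℕ := fun x => if 1 ≤ x ∧ x ≤ d then x + 1 else x

/-- `inc^d_{i,j}`: maps every `x` with `i ≤ x ≤ j` to `j` and fixes all other inputs. -/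
def incIJ (i j : ℕ) : ℕ → ℕ := fun x => if i ≤ x ∧ x ≤ j then j else x

/-- `dec^d_{i,j}`: maps every `x` with `i ≤ x ≤ j` to `i` and fixes all other inputs. -/
def decIJ (i j : ℕ) : ℕ → ℕ := fun x => if i ≤ x ∧ x ≤ j then i else x

/-- The basic functions relative to `d`. -/
def IsBasicFun (d : ℕ) (f : ℕ → ℕ) : Prop :=
  f = id ∨ (∃ i, 1 ≤ i ∧ i ≤ d ∧ f = decAt i) ∨ f = incUpTo d

/-- The advanced functions relative to `d`. -/
def IsAdvancedFun (d : ℕ) (f : ℕ → ℕ) : Prop :=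
  (∃ i, 1 ≤ i ∧ i ≤ d ∧ f = incAt i) ∨
  (∃ i j, 1 ≤ i ∧ i < j ∧ j ≤ d + 1 ∧ f = incIJ i j) ∨
  (∃ i j, i < j ∧ j ≤ d ∧ f = decIJ i j)

/-- The number of fixed points of `f` on the domain `{0, …, d+1}`. -/
def fixCount (d : ℕ) (f : ℕ → ℕ) : ℕ :=
  ((Finset.range (d + 2)).filter fun x => f x = x).card

/-- The disjoint union of `G₁` and `G₂` together with the edge `a b`. -/
def joinGraph {V₁ V₂ : Type} (G₁ : SimpleGraph V₁) (G₂ : SimpleGraph V₂)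
    (a : V₁) (b : V₂) : SimpleGraph (V₁ ⊕ V₂) :=
  SimpleGraph.fromRel fun x y =>
    (∃ u w, x = Sum.inl u ∧ y = Sum.inl w ∧ G₁.Adj u w) ∨
    (∃ u w, x = Sum.inr u ∧ y = Sum.inr w ∧ G₂.Adj u w) ∨
    (x = Sum.inl a ∧ y = Sum.inr b)

/-- `s` agrees on `{0, …, d}` with a composition of at most `n` basic functions. -/
def IsBasicComp (d n : ℕ) (s : ℕ → ℕ) : Prop :=
  ∃ L : List (ℕ → ℕ), L.length ≤ n ∧ (∀ g ∈ L, IsBasicFun d g) ∧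
    ∀ x ≤ d, compList L.reverse x = s x

namespace IsBasicComp

variable {d n m : ℕ} {s t : ℕ → ℕ}

theorem id_zero (d : ℕ) : IsBasicComp d 0 id :=
  ⟨[], by simp [compList]⟩

theorem mono (h : IsBasicComp d n s) (hnm : n ≤ m) : IsBasicComp d m s :=
  let ⟨L, hL, hb, hs⟩ := h
  ⟨L, hL.trans hnm, hb, hs⟩

theorem congr (h : IsBasicComp d n s) (hst : ∀ x ≤ d, s x = t x) : IsBasicComp d n t :=
  let ⟨L, hL, hb, hs⟩ := h
  ⟨L, hL, hb, fun x hx => (hs x hx).trans (hst x hx)⟩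

theorem step {g : ℕ → ℕ} (h : IsBasicComp d n s) (hg : IsBasicFun d g)
    (hst : ∀ x ≤ d, g (s x) = t x) : IsBasicComp d (n + 1) t := by
  obtain ⟨L, hL, hb, hs⟩ := h
  refine ⟨L ++ [g], by simpa using hL, ?_, fun x hx => ?_⟩
  · intro g' hg'
    rcases List.mem_append.1 hg' with h' | h'
    · exact hb g' h'
    · rwa [List.mem_singleton.1 h']
  · rw [List.reverse_append, ← hst x hx, ← hs x hx]
    rfl

end IsBasicComp

theorem compList_apply_top {d : ℕ} (L : List (ℕ → ℕ)) (hL : ∀ g ∈ L, IsBasicFun d g) :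
    compList L (d + 1) = d + 1 := by
  induction L with
  | nil => rfl
  | cons g L ih =>
    have hg : g (d + 1) = d + 1 := by
      rcases hL g (by simp) with rfl | ⟨i, -, hi, rfl⟩ | rfl
      · rfl
      · simp only [decAt]; split_ifs <;> omega
      · simp only [incUpTo]; split_ifs <;> omega
    change g (compList L (d + 1)) = d + 1
    rw [ih fun g' hg' => hL g' (by simp [hg']), hg]

/-- A monotone `c` with `x - e ≤ c x ≤ x` is a composition of `d * e` decrements: the values
`1, …, d` are moved down one after the other. -/
theorem isBasicComp_of_le_self {d e : ℕ} {c : ℕ → ℕ} (hc : Monotone c) (hle : ∀ x, c x ≤ x)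
    (he : ∀ x ≤ d, x ≤ c x + e) : IsBasicComp d (d * e) c := by
  have move : ∀ k ≤ d, IsBasicComp d (k * e) fun x => if x ≤ k then c x else x := by
    intro k
    induction k with
    | zero =>
      refine fun _ => ((IsBasicComp.id_zero d).mono (Nat.zero_le _)).congr fun x _ => ?_
      have := hle 0
      simp only [id]
      split_ifs with h
      · obtain rfl : x = 0 := by omega
        omega
      · rfl
    | succ k ih =>
      intro hk
      have moveOne : ∀ j ≤ k + 1 - c (k + 1), IsBasicComp d (k * e + j) fun x =>
          if x ≤ k then c x else if x = k + 1 then k + 1 - j else x := by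
        intro j
        induction j with
        | zero =>
          refine fun _ => (ih (by omega)).congr fun x _ => ?_
          split_ifs <;> omega
        | succ j ihj =>
          intro hj
          refine (ihj (by omega)).step (g := decAt (k + 1 - j))
            (Or.inr (Or.inl ⟨_, by omega, by omega, rfl⟩)) fun x _ => ?_
          have : x ≤ k → c x ≤ c (k + 1) := fun h => hc (by omega)
          simp only [decAt]
          split_ifs <;> omega
      have hke := he (k + 1) hk
      have hck := hle (k + 1)
      refine ((moveOne _ le_rfl).mono (m := (k + 1) * e) ?_).congr fun x _ => ?_
      · rw [Nat.succ_mul]; omega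
      · by_cases hx : x = k + 1
        · subst hx
          simp; omega
        · split_ifs <;> omega
  exact (move d le_rfl).congr fun x hx => if_pos hx

/-- If `c` is a composition of `n` basic functions and `f` is obtained from `c` by increasing its
values without changing its fibres, then `f` is a composition of `n + (f d - c d) * c d` basic
functions: in each round all values are increased, and those that were already large enough are
decreased again. -/
theorem IsBasicComp.expand {d n : ℕ} {c f : ℕ → ℕ} (h : IsBasicComp d n c)
    (hc : Monotone c) (hle : ∀ x ≤ d, c x ≤ f x) (htop : f d ≤ d + 1)
    (hzero : ∀ x ≤ d, c x = 0 → f x = 0)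
    (hlt : ∀ x ≤ d, ∀ y ≤ d, c x < c y → f x < f y)
    (heq : ∀ x ≤ d, ∀ y ≤ d, c x = c y → f x = f y)
    (hshift : ∀ x ≤ d, f x + c d ≤ f d + c x) :
    IsBasicComp d (n + (f d - c d) * c d) f := by
  have hd := hle d le_rfl
  have round : ∀ s ≤ f d - c d,
      IsBasicComp d (n + s * c d) fun x => min (c x + s) (f x) := by
    intro s
    induction s with
    | zero =>
      refine fun _ => (h.mono (by omega)).congr fun x hx => ?_
      have := hle x hx
      omega
    | succ s ih =>
      intro hs
      have partialRound : ∀ k, k + 1 ≤ c d → IsBasicComp d (n + s * c d + (k + 1)) fun x =>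
          if c x ≤ k then min (c x + (s + 1)) (f x) else min (c x + s) (f x) + 1 := by
        intro k
        induction k with
        | zero =>
          refine fun _ => (ih (by omega)).step (Or.inr (Or.inr rfl)) fun x hx => ?_
          have h1 := hle x hx
          have h2 := hzero x hx
          have h3 := hc hx
          simp only [incUpTo]
          split_ifs <;> omega
        | succ k ihk =>
          intro hk
          by_cases hy : ∃ y ≤ d, c y = k + 1 ∧ f y ≤ k + 1 + s
          · obtain ⟨y, hyd, hcy, hfy⟩ := hy
            refine (ihk (by omega)).step (g := decAt (f y + 1))
              (Or.inr (Or.inl ⟨_, by omega, by omega, rfl⟩)) fun x hx => ?_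
            have h1 := hlt x hx y hyd
            have h2 := heq x hx y hyd
            have h3 := hlt y hyd x hx
            simp only [decAt]
            split_ifs <;> omega
          · refine (ihk (by omega)).step (Or.inl rfl) fun x hx => ?_
            have h1 : ¬ (c x = k + 1 ∧ f x ≤ k + 1 + s) := fun h => hy ⟨x, hx, h⟩
            simp only [id]
            split_ifs <;> omega
      rcases Nat.eq_zero_or_pos (c d) with h0 | hpos
      · have := hzero d le_rfl h0
        omega
      · refine ((partialRound (c d - 1) (by omega)).mono
          (m := n + (s + 1) * c d) ?_).congr fun x hx => ?_
        · rw [Nat.succ_mul]; omega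
        · have h1 := hc hx
          have h2 := heq x hx d le_rfl
          split_ifs <;> omega
  refine (round _ le_rfl).congr fun x hx => ?_
  have := hshift x hx
  omega

/-- The number of strict increases of `f` on `{0, …, x}`. -/
def strictIncreases (f : ℕ → ℕ) : ℕ → ℕ
  | 0 => 0
  | x + 1 => strictIncreases f x + if f x < f (x + 1) then 1 else 0

theorem strictIncreases_succ (f : ℕ → ℕ) (x : ℕ) :
    strictIncreases f (x + 1) = strictIncreases f x + if f x < f (x + 1) then 1 else 0 :=
  rfl

theorem monotone_strictIncreases (f : ℕ → ℕ) : Monotone (strictIncreases f) :=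
  monotone_nat_of_le_succ fun _ => Nat.le_add_right _ _

theorem strictIncreases_add_spec {d : ℕ} {f : ℕ → ℕ}
    (hmono : ∀ x y : ℕ, x ≤ y → y ≤ d → f x ≤ f y) {x k : ℕ} (hk : x + k ≤ d) :
    strictIncreases f (x + k) + f x ≤ strictIncreases f x + f (x + k) ∧
      (strictIncreases f (x + k) = strictIncreases f x → f (x + k) = f x) ∧
      (strictIncreases f x < strictIncreases f (x + k) → f x < f (x + k)) := by
  induction k with
  | zero => simp
  | succ k ih =>
    obtain ⟨h1, h2, h3⟩ := ih (by omega)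
    have h4 := hmono (x + k) (x + k + 1) (by omega) (by omega)
    have h5 := hmono x (x + k) (by omega) (by omega)
    have h6 := monotone_strictIncreases f (Nat.le_add_right x k)
    simp only [← Nat.add_assoc, strictIncreases_succ]
    split_ifs <;> omega

theorem strictIncreases_add_le (f : ℕ → ℕ) (x k : ℕ) :
    strictIncreases f (x + k) ≤ strictIncreases f x + k := by
  induction k with
  | zero => simp
  | succ k ih =>
    simp only [← Nat.add_assoc, strictIncreases_succ]
    split_ifs <;> omega

theorem strictIncreases_le_self (f : ℕ → ℕ) (x : ℕ) : strictIncreases f x ≤ x := by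
  simpa [strictIncreases] using strictIncreases_add_le f 0 x

theorem isBasicComp_of_monotone {d : ℕ} {f : ℕ → ℕ} (hdom : f d ≤ d + 1)
    (hmono : ∀ x y : ℕ, x ≤ y → y ≤ d → f x ≤ f y) (h0 : f 0 = 0) :
    IsBasicComp d (d ^ 2) f := by
  set c := strictIncreases f
  have hc : Monotone c := monotone_strictIncreases f
  have spec : ∀ x y, x ≤ y → y ≤ d → c y + f x ≤ c x + f y ∧
      (c y = c x → f y = f x) ∧ (c x < c y → f x < f y) := by
    intro x y hxy hy
    obtain ⟨k, rfl⟩ := Nat.exists_eq_add_of_le hxy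
    exact strictIncreases_add_spec hmono hy
  have hc0 : c 0 = 0 := rfl
  have hcd : c d ≤ d := strictIncreases_le_self f d
  have hcle : ∀ x ≤ d, x ≤ c x + (d - c d) := by
    intro x hx
    have : c (x + (d - x)) ≤ c x + (d - x) := strictIncreases_add_le f x (d - x)
    rw [Nat.add_sub_cancel' hx] at this
    omega
  have key := (isBasicComp_of_le_self hc (strictIncreases_le_self f) hcle).expand (f := f) hc
    (fun x hx => by have := (spec 0 x (Nat.zero_le _) hx).1; omega) hdom
    (fun x hx h => by have := (spec 0 x (Nat.zero_le _) hx).2.1; omega)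
    (fun x hx y hy h => (spec x y (hc.reflect_lt h).le hy).2.2 h)
    (fun x hx y hy h => by
      rcases le_total x y with hxy | hxy
      · exact ((spec x y hxy hy).2.1 h.symm).symm
      · exact (spec y x hxy hx).2.1 h)
    (fun x hx => by have := (spec x d hx le_rfl).1; omega)
  refine key.mono ?_
  generalize c d = M at hcd ⊢
  obtain ⟨e, he⟩ := Nat.exists_eq_add_of_le hcd
  calc d * (d - M) + (f d - M) * M ≤ d * e + (e + 1) * M := by
        gcongr <;> omega
    _ ≤ d ^ 2 := by
        rw [he]
        nlinarith [Nat.le_mul_self M]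

/-- Let `d ≥ 1` and `f : {0,…,d+1} → {0,…,d+1}` non-decreasing with
`f 0 = 0` and `f (d+1) = d+1`. Then there are `ℓ ≤ d³` basic functions `g₁,…,g_ℓ`
relative to `d` such that `f = g_ℓ ∘ g_{ℓ−1} ∘ ⋯ ∘ g₁` (as functions on `{0,…,d+1}`). -/
theorem stmt11 (d : ℕ) (hd : 1 ≤ d) (f : ℕ → ℕ)
    (hdom : ∀ x ≤ d + 1, f x ≤ d + 1)
    (hmono : ∀ x y : ℕ, x ≤ y → y ≤ d + 1 → f x ≤ f y)
    (h0 : f 0 = 0) (htop : f (d + 1) = d + 1) :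
    ∃ L : List (ℕ → ℕ), L.length ≤ d ^ 3 ∧ (∀ g ∈ L, IsBasicFun d g) ∧
      ∀ x ≤ d + 1, f x = compList L.reverse x := by
  obtain ⟨L, hL, hb, hs⟩ := isBasicComp_of_monotone (hdom d (by omega))
    (fun x y hxy hy => hmono x y hxy (by omega)) h0
  refine ⟨L, hL.trans (Nat.pow_le_pow_right hd (by norm_num)), hb, fun x hx => ?_⟩
  rcases Nat.lt_or_eq_of_le hx with h | rfl
  · exact (hs x (by omega)).symm
  · rw [htop, compList_apply_top _ fun g hg => hb g (List.mem_reverse.1 hg)]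

end CocPaper
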